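/- Define u : ℝ × (0,∞) → ℝ by u(x,t) = 2t/(t² + x²). Then u is everywhere positive and satisfies the logarithmic fast diffusion equation ∂_t u = ∂_x² (log u) at every (x,t) ∈ ℝ × (0,∞). -/

import Mathlib

theorem hasDerivAt_const_add_sq (c y : ℝ) : HasDerivAt (fun z : ℝ => c + z ^ 2) (2 * y) y := by
  simpa using (hasDerivAt_pow 2 y).const_add c

theorem hasDerivAt_log_soliton {t : ℝ} (ht : 0 < t) (y : ℝ) :
    HasDerivAt (fun z => Real.log (2 * t / (t ^ 2 + z ^ 2))) (-(2 * y) / (t ^ 2 + y ^ 2)) y := by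
  have hD : ∀ z : ℝ, t ^ 2 + z ^ 2 ≠ 0 := fun z => by positivity
  have hlog : (fun z => Real.log (2 * t / (t ^ 2 + z ^ 2))) =
      fun z => Real.log (2 * t) - Real.log (t ^ 2 + z ^ 2) :=
    funext fun z => Real.log_div (by positivity) (hD z)
  rw [hlog, neg_div]
  exact ((hasDerivAt_const_add_sq (t ^ 2) y).log (hD y)).const_sub _

/-- The function `u(x,t) = 2t/(t² + x²)` is positive on `ℝ × (0,∞)` and
satisfies the logarithmic fast diffusion equation `∂ₜ u = ∂ₓ² (log u)` there. -/
theorem soliton_solves_lfde :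
    ∀ x : ℝ, ∀ t : ℝ, 0 < t →
      0 < 2 * t / (t ^ 2 + x ^ 2)
      ∧ deriv (fun s => 2 * s / (s ^ 2 + x ^ 2)) t
          = deriv (deriv (fun y => Real.log (2 * t / (t ^ 2 + y ^ 2)))) x := by
  intro x t ht
  have hD : t ^ 2 + x ^ 2 ≠ 0 := by positivity
  have hlin (y : ℝ) : HasDerivAt (fun s : ℝ => 2 * s) 2 y := by
    simpa using (hasDerivAt_id y).const_mul (2 : ℝ)
  have hsq : HasDerivAt (fun s : ℝ => s ^ 2 + x ^ 2) (2 * t) t := by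
    simpa [add_comm] using hasDerivAt_const_add_sq (x ^ 2) t
  have htime : HasDerivAt (fun s => 2 * s / (s ^ 2 + x ^ 2))
      ((2 * (t ^ 2 + x ^ 2) - 2 * t * (2 * t)) / (t ^ 2 + x ^ 2) ^ 2) t :=
    (hlin t).fun_div hsq hD
  have hspace : HasDerivAt (fun y => -(2 * y) / (t ^ 2 + y ^ 2))
      ((-2 * (t ^ 2 + x ^ 2) - -(2 * x) * (2 * x)) / (t ^ 2 + x ^ 2) ^ 2) x :=
    (hlin x).fun_neg.fun_div (hasDerivAt_const_add_sq (t ^ 2) x) hD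
  refine ⟨by positivity, ?_⟩
  rw [htime.deriv, funext fun y => (hasDerivAt_log_soliton ht y).deriv, hspace.deriv]
  ring
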